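/- The value function u is locally Lipschitz continuous on ℝ^n × [0,T]: for every compact set 𝒳 ⊆ ℝ^n there exists a constant C ≥ 0 such that |u(x₁,t₁) − u(x₂,t₂)| ≤ C(‖x₁ − x₂‖ + |t₁ − t₂|) for all x₁, x₂ ∈ 𝒳 and all t₁, t₂ ∈ [0,T]. -/

import Mathlib

open Set MeasureTheory RealInnerProductSpace Filter Topology

noncomputable section

abbrev EucSp (n : ℕ) : Type := EuclideanSpace ℝ (Fin n)

/-- An admissible uncertainty on `[t, T]`: a measurable map taking values in `D` there. -/
def Admissible {m : ℕ} (D : Set (EucSp m)) (t T : ℝ) (d : ℝ → EucSp m) : Prop :=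
  Measurable d ∧ ∀ s ∈ Set.Icc t T, d s ∈ D

/-- `y` solves `ẏ(s) = F (y s) (d s)` on `[t, T]` with `y t = x` (integral form,
equivalent to absolute continuity together with the a.e. differential equation). -/
def IsTraj {n m : ℕ} (F : EucSp n → EucSp m → EucSp n) (d : ℝ → EucSp m)
    (t T : ℝ) (x : EucSp n) (y : ℝ → EucSp n) : Prop :=
  y t = x ∧ ∀ s ∈ Set.Icc t T, y s = x + ∫ r in t..s, F (y r) (d r)

/-- The payoff of a trajectory `y` on `[t, T]`:
`max { max_j l_j (y T), max_i sup_{s ∈ [t,T]} g_i (y s, s) }`. -/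
def payoff {n nX nTR : ℕ} (g : Fin nX → EucSp n → ℝ → ℝ) (l : Fin nTR → EucSp n → ℝ)
    (t T : ℝ) (y : ℝ → EucSp n) : ℝ :=
  max (⨆ j, l j (y T)) (⨆ i, sSup ((fun s => g i (y s) s) '' Set.Icc t T))

/-- The defining property of the value function `u`: for `(x, t) ∈ ℝⁿ × [0, T]`,
`u (x, t)` is the supremum of the payoffs over all admissible uncertainties on `[t, T]`
(the trajectory being the unique solution of the ODE driven by the uncertainty). -/
def IsValueFun {n m nX nTR : ℕ} (F : EucSp n → EucSp m → EucSp n) (D : Set (EucSp m))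
    (g : Fin nX → EucSp n → ℝ → ℝ) (l : Fin nTR → EucSp n → ℝ) (T : ℝ)
    (u : EucSp n → ℝ → ℝ) : Prop :=
  ∀ x : EucSp n, ∀ t ∈ Set.Icc (0:ℝ) T,
    u x t = sSup {r | ∃ d y, Admissible D t T d ∧ IsTraj F d t T x y ∧
      r = payoff g l t T y}

/-- The Hamiltonian `H(x, p) = max_{d ∈ D} ⟪p, F x d⟫`. -/
def Ham {n m : ℕ} (F : EucSp n → EucSp m → EucSp n) (D : Set (EucSp m))
    (x p : EucSp n) : ℝ :=
  sSup ((fun d => ⟪p, F x d⟫) '' D)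

/-- Viscosity super-solution of `max{∂ₜ w + H(x, ∇ₓ w), maxᵢ gᵢ(x,t) - w} = 0` on
`ℝⁿ × [0, T]`: a lower semicontinuous function such that for every smooth test function
`ψ` such that `w - ψ` attains a local minimum at `(x₀, t₀) ∈ ℝⁿ × [0, T]`, one has
`max{∂ₜ ψ(x₀,t₀) + H(x₀, ∇ₓ ψ(x₀,t₀)), maxᵢ gᵢ(x₀,t₀) - w(x₀,t₀)} ≤ 0`. -/
def ViscSuper {n m nX : ℕ} (F : EucSp n → EucSp m → EucSp n) (D : Set (EucSp m))
    (g : Fin nX → EucSp n → ℝ → ℝ) (T : ℝ) (w : EucSp n → ℝ → ℝ) : Prop :=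
  LowerSemicontinuousOn (fun p : EucSp n × ℝ => w p.1 p.2) (Set.univ ×ˢ Set.Icc 0 T) ∧
  ∀ ψ : EucSp n → ℝ → ℝ, ContDiff ℝ (⊤ : ℕ∞) (fun p : EucSp n × ℝ => ψ p.1 p.2) →
    ∀ x₀ : EucSp n, ∀ t₀ ∈ Set.Icc (0:ℝ) T,
      IsLocalMinOn (fun p : EucSp n × ℝ => w p.1 p.2 - ψ p.1 p.2)
        (Set.univ ×ˢ Set.Icc 0 T) (x₀, t₀) →
      max (deriv (ψ x₀) t₀ + Ham F D x₀ (gradient (fun z => ψ z t₀) x₀))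
        ((⨆ i, g i x₀ t₀) - w x₀ t₀) ≤ 0

/-- Viscosity sub-solution of `max{∂ₜ w + H(x, ∇ₓ w), maxᵢ gᵢ(x,t) - w} = 0` on
`ℝⁿ × [0, T]`. -/
def ViscSub {n m nX : ℕ} (F : EucSp n → EucSp m → EucSp n) (D : Set (EucSp m))
    (g : Fin nX → EucSp n → ℝ → ℝ) (T : ℝ) (w : EucSp n → ℝ → ℝ) : Prop :=
  UpperSemicontinuousOn (fun p : EucSp n × ℝ => w p.1 p.2) (Set.univ ×ˢ Set.Icc 0 T) ∧
  ∀ ψ : EucSp n → ℝ → ℝ, ContDiff ℝ (⊤ : ℕ∞) (fun p : EucSp n × ℝ => ψ p.1 p.2) →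
    ∀ x₀ : EucSp n, ∀ t₀ ∈ Set.Icc (0:ℝ) T,
      IsLocalMaxOn (fun p : EucSp n × ℝ => w p.1 p.2 - ψ p.1 p.2)
        (Set.univ ×ˢ Set.Icc 0 T) (x₀, t₀) →
      0 ≤ max (deriv (ψ x₀) t₀ + Ham F D x₀ (gradient (fun z => ψ z t₀) x₀))
        ((⨆ i, g i x₀ t₀) - w x₀ t₀)

/-- The backward reachable set at time `t` (horizon `T`) of the target `{maxⱼ lⱼ ≤ 0}`
under state constraints `{maxᵢ gᵢ(·, s) ≤ 0}`, for the dynamics `f` driven by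
uncertainties in `D`: the set of `x` such that for every admissible uncertainty the
(unique) solution extends to all of `[t, T]`, respects the state constraints there,
and ends up in the target at time `T`. -/
def Reach {n m nX nTR : ℕ} (f : EucSp n → EucSp m → EucSp n) (D : Set (EucSp m))
    (g : Fin nX → EucSp n → ℝ → ℝ) (l : Fin nTR → EucSp n → ℝ)
    (t T : ℝ) : Set (EucSp n) :=
  {x | ∀ d, Admissible D t T d → ∃ y, IsTraj f d t T x y ∧
    (∀ s ∈ Set.Icc t T, ∀ i, g i (y s) s ≤ 0) ∧ ∀ j, l j (y T) ≤ 0}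

/-- Grönwall's inequality in integral form, with a constant forcing term. -/
lemma le_mul_exp_of_le_add_mul_integral {e : ℝ → ℝ} {a K t τ : ℝ} (hK : 0 ≤ K)
    (hc : ContinuousOn e (Icc t τ)) (h0 : ∀ s ∈ Icc t τ, 0 ≤ e s)
    (h : ∀ s ∈ Icc t τ, e s ≤ a + K * ∫ r in t..s, e r) :
    ∀ s ∈ Icc t τ, e s ≤ a * Real.exp (K * (s - t)) := by
  intro s hs
  have htτ : t ≤ τ := hs.1.trans hs.2
  set e' : ℝ → ℝ := IccExtend htτ ((Icc t τ).domRestrict e) with he'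
  have hce' : Continuous e' := (continuousOn_iff_continuous_domRestrict.1 hc).Icc_extend'
  have hee' : ∀ r ∈ Icc t τ, e' r = e r := fun r hr => by
    rw [he', IccExtend_of_mem _ _ hr]; rfl
  have hint : ∀ r ∈ Icc t τ, ∫ q in t..r, e' q = ∫ q in t..r, e q := fun r hr =>
    intervalIntegral.integral_congr fun q hq => by
      rw [uIcc_of_le hr.1] at hq
      exact hee' q ⟨hq.1, hq.2.trans hr.2⟩
  have ha : 0 ≤ a := by
    have h1 := h t ⟨le_rfl, htτ⟩
    have h2 := h0 t ⟨le_rfl, htτ⟩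
    simp only [intervalIntegral.integral_same, mul_zero, add_zero] at h1
    linarith
  have hderiv : ∀ r, HasDerivAt (fun r => a + K * ∫ q in t..r, e' q) (K * e' r) r := fun r =>
    ((intervalIntegral.integral_hasDerivAt_right (hce'.intervalIntegrable _ _)
      hce'.stronglyMeasurable.stronglyMeasurableAtFilter hce'.continuousAt).const_mul K).const_add a
  have key := norm_le_gronwallBound_of_norm_deriv_right_le (δ := a) (K := K) (ε := 0) (a := t)
    (b := τ) (f := fun r => a + K * ∫ q in t..r, e' q) (f' := fun r => K * e' r)
    (fun r _ => (hderiv r).continuousAt.continuousWithinAt)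
    (fun r _ => (hderiv r).hasDerivWithinAt) (by simp [abs_of_nonneg ha])
    (by
      intro r hr
      have hr' : r ∈ Icc t τ := ⟨hr.1, hr.2.le⟩
      rw [hee' r hr', hint r hr', add_zero, Real.norm_of_nonneg (mul_nonneg hK (h0 r hr'))]
      exact mul_le_mul_of_nonneg_left ((h r hr').trans (Real.le_norm_self _)) hK) s hs
  rw [gronwallBound_ε0, hint s hs] at key
  exact ((h s hs).trans (Real.le_norm_self _)).trans key

/-- The standing assumptions on the dynamics: joint continuity, a uniform Lipschitz constant in
the state, and a bound on the velocities at the origin. -/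
structure IsLipschitzDynamics {n m : ℕ} (F : EucSp n → EucSp m → EucSp n) (D : Set (EucSp m))
    (K M : ℝ) : Prop where
  continuous : Continuous fun p : EucSp n × EucSp m => F p.1 p.2
  lipschitz : ∀ x y : EucSp n, ∀ d ∈ D, ‖F x d - F y d‖ ≤ K * ‖x - y‖
  nonneg_lipschitz : 0 ≤ K
  nonneg_bound : 0 ≤ M
  bound : ∀ d ∈ D, ‖F 0 d‖ ≤ M

namespace IsLipschitzDynamics

variable {n m : ℕ} {F : EucSp n → EucSp m → EucSp n} {D : Set (EucSp m)} {K M : ℝ}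
  {d : ℝ → EucSp m} {t τ T : ℝ} {x : EucSp n} {y z : ℝ → EucSp n}

lemma norm_le (hF : IsLipschitzDynamics F D K M) (x : EucSp n) {v : EucSp m} (hv : v ∈ D) :
    ‖F x v‖ ≤ M + K * ‖x‖ := by
  have h1 := hF.lipschitz x 0 v hv
  have h2 := hF.bound v hv
  have h3 := norm_add_le (F x v - F 0 v) (F 0 v)
  rw [sub_add_cancel] at h3
  rw [sub_zero] at h1
  linarith

lemma intervalIntegrable_of_bound (hF : IsLipschitzDynamics F D K M) (hd : Measurable d)
    (hdD : ∀ s, d s ∈ D) (htτ : t ≤ τ) {B : ℝ}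
    (hy : AEMeasurable y (volume.restrict (Ioc t τ))) (hB : ∀ r ∈ Ioc t τ, ‖y r‖ ≤ B) :
    IntervalIntegrable (fun r => F (y r) (d r)) volume t τ := by
  rw [intervalIntegrable_iff_integrableOn_Ioc_of_le htτ]
  refine IntegrableOn.of_bound (C := M + K * B) measure_Ioc_lt_top ?_ ?_
  · exact (hF.continuous.measurable.comp_aemeasurable
      (hy.prodMk hd.aemeasurable)).aestronglyMeasurable
  · refine (ae_restrict_iff' measurableSet_Ioc).2 (Eventually.of_forall fun r hr => ?_)
    exact (hF.norm_le _ (hdD r)).trans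
      (by have := mul_le_mul_of_nonneg_left (hB r hr) hF.nonneg_lipschitz; linarith)

lemma intervalIntegrable (hF : IsLipschitzDynamics F D K M) (hd : Measurable d)
    (hdD : ∀ s, d s ∈ D) (htτ : t ≤ τ) (hy : ContinuousOn y (Icc t τ)) :
    IntervalIntegrable (fun r => F (y r) (d r)) volume t τ := by
  obtain ⟨B, hB⟩ := isCompact_Icc.exists_bound_of_continuousOn hy
  exact hF.intervalIntegrable_of_bound hd hdD htτ
    ((hy.mono Ioc_subset_Icc_self).aemeasurable measurableSet_Ioc)
    fun r hr => hB r (Ioc_subset_Icc_self hr)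

/-- Continuous trajectories driven by the same uncertainty depend Lipschitz continuously on the
initial state. -/
lemma norm_sub_le (hF : IsLipschitzDynamics F D K M) (hd : Measurable d) (hdD : ∀ s, d s ∈ D)
    {a b : EucSp n} (hy : ContinuousOn y (Icc t τ)) (hz : ContinuousOn z (Icc t τ))
    (hya : IsTraj F d t τ a y) (hzb : IsTraj F d t τ b z) :
    ∀ s ∈ Icc t τ, ‖y s - z s‖ ≤ ‖a - b‖ * Real.exp (K * (s - t)) := by
  refine le_mul_exp_of_le_add_mul_integral (e := fun s => ‖y s - z s‖) hF.nonneg_lipschitz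
    (hy.sub hz).norm (fun _ _ => norm_nonneg _) fun s hs => ?_
  have hsub : Icc t s ⊆ Icc t τ := Icc_subset_Icc le_rfl hs.2
  have hiy := hF.intervalIntegrable hd hdD hs.1 (hy.mono hsub)
  have hiz := hF.intervalIntegrable hd hdD hs.1 (hz.mono hsub)
  have hie : IntervalIntegrable (fun r => K * ‖y r - z r‖) volume t s := by
    refine ContinuousOn.intervalIntegrable ?_
    rw [uIcc_of_le hs.1]
    exact continuousOn_const.mul ((hy.sub hz).norm.mono hsub)
  have heq : y s - z s = (a - b) + ∫ r in t..s, (F (y r) (d r) - F (z r) (d r)) := by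
    rw [intervalIntegral.integral_sub hiy hiz, hya.2 s hs, hzb.2 s hs]
    abel
  have hint : ‖∫ r in t..s, (F (y r) (d r) - F (z r) (d r))‖ ≤ ∫ r in t..s, K * ‖y r - z r‖ :=
    intervalIntegral.norm_integral_le_of_norm_le hs.1
      (Eventually.of_forall fun r _ => hF.lipschitz _ _ _ (hdD r)) hie
  rw [intervalIntegral.integral_const_mul] at hint
  change ‖y s - z s‖ ≤ _
  rw [heq]
  exact (norm_add_le _ _).trans (by linarith)

/-- A priori bound on continuous trajectories. -/
lemma norm_traj_le (hF : IsLipschitzDynamics F D K M) (hdD : ∀ s, d s ∈ D)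
    (hy : ContinuousOn y (Icc t τ)) (hyx : IsTraj F d t τ x y) :
    ∀ s ∈ Icc t τ, ‖y s‖ ≤ (‖x‖ + M * (τ - t)) * Real.exp (K * (s - t)) := by
  refine le_mul_exp_of_le_add_mul_integral (e := fun s => ‖y s‖) hF.nonneg_lipschitz
    hy.norm (fun _ _ => norm_nonneg _) fun s hs => ?_
  have hie : IntervalIntegrable (fun r => K * ‖y r‖) volume t s := by
    refine ContinuousOn.intervalIntegrable ?_
    rw [uIcc_of_le hs.1]
    exact continuousOn_const.mul (hy.norm.mono (Icc_subset_Icc le_rfl hs.2))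
  have hint : ‖∫ r in t..s, F (y r) (d r)‖ ≤ ∫ r in t..s, (M + K * ‖y r‖) :=
    intervalIntegral.norm_integral_le_of_norm_le hs.1
      (Eventually.of_forall fun r _ => hF.norm_le _ (hdD r))
      (intervalIntegrable_const.add hie)
  rw [intervalIntegral.integral_add intervalIntegrable_const hie,
    intervalIntegral.integral_const_mul, intervalIntegral.integral_const, smul_eq_mul] at hint
  have hM : (s - t) * M ≤ M * (τ - t) := by nlinarith [hF.nonneg_bound, hs.2]
  change ‖y s‖ ≤ _
  rw [hyx.2 s hs]
  refine (norm_add_le _ _).trans ?_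
  linarith

/-- Existence of a continuous trajectory, by the contraction principle in an exponentially
weighted norm. -/
lemma exists_traj (hF : IsLipschitzDynamics F D K M) (hd : Measurable d) (hdD : ∀ s, d s ∈ D)
    (htT : t ≤ T) (x : EucSp n) : ∃ y, Continuous y ∧ IsTraj F d t T x y := by
  set L : ℝ := K + 1 with hL
  have hL0 : 0 < L := by have := hF.nonneg_lipschitz; linarith
  let lift : C(Icc t T, EucSp n) → ℝ → EucSp n := fun w r =>
    Real.exp (2 * L * r) • w (projIcc t T htT r)
  have hlift : ∀ w, Continuous (lift w) := fun w => by
    have : Continuous fun r => w (projIcc t T htT r) := w.continuous.comp continuous_projIcc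
    fun_prop
  have hii : ∀ w a b, IntervalIntegrable (fun r => F (lift w r) (d r)) volume a b := by
    intro w a b
    rcases le_total a b with hab | hab
    · exact hF.intervalIntegrable hd hdD hab (hlift w).continuousOn
    · exact (hF.intervalIntegrable hd hdD hab (hlift w).continuousOn).symm
  let Φ : C(Icc t T, EucSp n) → C(Icc t T, EucSp n) := fun w =>
    ⟨fun s => Real.exp (-(2 * L * s)) • (x + ∫ r in t..s, F (lift w r) (d r)), by
      have := (intervalIntegral.continuous_primitive (hii w) t).comp
        (continuous_subtype_val (p := fun s => s ∈ Icc t T))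
      simp only [Function.comp_def] at this
      fun_prop⟩
  have hΦ : ContractingWith (1 / 2) Φ := by
    refine ⟨by rw [← NNReal.coe_lt_coe]; norm_num, LipschitzWith.of_dist_le_mul fun w v => ?_⟩
    rw [ContinuousMap.dist_le (by positivity)]
    rintro ⟨s, hs⟩
    have hbound : ‖∫ r in t..s, (F (lift w r) (d r) - F (lift v r) (d r))‖
        ≤ ∫ r in t..s, dist w v / 2 * (Real.exp (2 * L * r) * (2 * L)) := by
      refine intervalIntegral.norm_integral_le_of_norm_le hs.1
        (Eventually.of_forall fun r _ => ?_) (Continuous.intervalIntegrable (by fun_prop) _ _)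
      have h1 := hF.lipschitz (lift w r) (lift v r) (d r) (hdD r)
      have h2 : ‖lift w r - lift v r‖ ≤ Real.exp (2 * L * r) * dist w v := by
        simp only [lift]
        rw [← smul_sub, norm_smul, Real.norm_of_nonneg (Real.exp_pos _).le, ← dist_eq_norm]
        exact mul_le_mul_of_nonneg_left (ContinuousMap.dist_apply_le_dist _) (Real.exp_pos _).le
      have h3 : K * ‖lift w r - lift v r‖ ≤ L * (Real.exp (2 * L * r) * dist w v) :=
        mul_le_mul (by linarith) h2 (norm_nonneg _) hL0.le
      linarith
    have hexp : ∫ r in t..s, dist w v / 2 * (Real.exp (2 * L * r) * (2 * L))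
        = dist w v / 2 * (Real.exp (2 * L * s) - Real.exp (2 * L * t)) := by
      rw [intervalIntegral.integral_const_mul, intervalIntegral.integral_eq_sub_of_hasDerivAt
        (f := fun r => Real.exp (2 * L * r))]
      · intro r _
        simpa using ((hasDerivAt_id r).const_mul (2 * L)).exp
      · exact Continuous.intervalIntegrable (by fun_prop) _ _
    rw [hexp] at hbound
    have heq : Φ w ⟨s, hs⟩ - Φ v ⟨s, hs⟩ = Real.exp (-(2 * L * s)) •
        ∫ r in t..s, (F (lift w r) (d r) - F (lift v r) (d r)) := by
      rw [intervalIntegral.integral_sub (hii w t s) (hii v t s)]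
      simp only [Φ, ContinuousMap.coe_mk]
      rw [← smul_sub]
      congr 1
      abel
    rw [dist_eq_norm, heq, norm_smul, Real.norm_of_nonneg (Real.exp_pos _).le]
    have hle : ‖∫ r in t..s, (F (lift w r) (d r) - F (lift v r) (d r))‖
        ≤ dist w v / 2 * Real.exp (2 * L * s) := hbound.trans
      (mul_le_mul_of_nonneg_left (by have := Real.exp_pos (2 * L * t); linarith) (by positivity))
    calc Real.exp (-(2 * L * s)) * ‖∫ r in t..s, (F (lift w r) (d r) - F (lift v r) (d r))‖
        ≤ Real.exp (-(2 * L * s)) * (dist w v / 2 * Real.exp (2 * L * s)) :=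
          mul_le_mul_of_nonneg_left hle (Real.exp_pos _).le
      _ = (Real.exp (-(2 * L * s)) * Real.exp (2 * L * s)) * (dist w v / 2) := by ring
      _ = ((1 / 2 : NNReal) : ℝ) * dist w v := by
          rw [← Real.exp_add, neg_add_cancel, Real.exp_zero]
          push_cast
          ring
  have hfix : Φ (hΦ.fixedPoint Φ) = hΦ.fixedPoint Φ := hΦ.fixedPoint_isFixedPt
  set w := hΦ.fixedPoint Φ
  have hsol : ∀ s ∈ Icc t T, lift w s = x + ∫ r in t..s, F (lift w r) (d r) := by
    intro s hs
    have h1 : w ⟨s, hs⟩ = Real.exp (-(2 * L * s)) • (x + ∫ r in t..s, F (lift w r) (d r)) :=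
      (DFunLike.congr_fun hfix ⟨s, hs⟩).symm
    change Real.exp (2 * L * s) • w (projIcc t T htT s) = _
    rw [projIcc_of_mem htT hs, h1, smul_smul, ← Real.exp_add, add_neg_cancel, Real.exp_zero,
      one_smul]
  refine ⟨lift w, hlift w, ?_, hsol⟩
  simpa using hsol t ⟨le_rfl, htT⟩

/-- Uniqueness of trajectories. The integral equation alone forces integrability of the velocity:
past the integrability threshold the Bochner integral would vanish, so the trajectory would be
constant there, hence bounded. -/
lemma traj_eqOn (hF : IsLipschitzDynamics F D K M) (hd : Measurable d) (hdD : ∀ s, d s ∈ D)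
    (htT : t ≤ T) (hz : Continuous z) (hzx : IsTraj F d t T x z) (hyx : IsTraj F d t T x y) :
    EqOn y z (Icc t T) := by
  classical
  have hmono : ∀ {r s : ℝ}, t ≤ r → r ≤ s →
      IntervalIntegrable (fun r => F (y r) (d r)) volume t s →
      IntervalIntegrable (fun r => F (y r) (d r)) volume t r := fun htr hrs h =>
    h.mono_set (by rw [uIcc_of_le htr, uIcc_of_le (htr.trans hrs)]; exact Icc_subset_Icc le_rfl hrs)
  have heq : ∀ s ∈ Icc t T, IntervalIntegrable (fun r => F (y r) (d r)) volume t s →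
      y s = z s := by
    intro s hs hint
    have hyc : ContinuousOn y (Icc t s) := by
      have h1 := intervalIntegral.continuousOn_primitive_interval' hint left_mem_uIcc
      rw [uIcc_of_le hs.1] at h1
      exact (continuousOn_const.add h1).congr fun r hr => hyx.2 r ⟨hr.1, hr.2.trans hs.2⟩
    have h2 := hF.norm_sub_le hd hdD hyc hz.continuousOn
      ⟨hyx.1, fun r hr => hyx.2 r ⟨hr.1, hr.2.trans hs.2⟩⟩
      ⟨hzx.1, fun r hr => hzx.2 r ⟨hr.1, hr.2.trans hs.2⟩⟩ s ⟨hs.1, le_rfl⟩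
    rw [sub_self, norm_zero, zero_mul] at h2
    exact sub_eq_zero.1 (norm_le_zero_iff.1 h2)
  set A : Set ℝ := {r | t ≤ r ∧ IntervalIntegrable (fun r => F (y r) (d r)) volume t r} with hA
  have hAm : MeasurableSet A := by
    refine OrdConnected.measurableSet ⟨fun r hr s hs q hq => ?_⟩
    exact ⟨hr.1.trans hq.1, hmono (hr.1.trans hq.1) hq.2 hs.2⟩
  have hyA : ∀ r ∈ Icc t T, y r = if r ∈ A then z r else x := by
    intro r hr
    split_ifs with h
    · exact heq r hr h.2
    · have : ¬ IntervalIntegrable (fun r => F (y r) (d r)) volume t r := fun h' => h ⟨hr.1, h'⟩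
      rw [hyx.2 r hr, intervalIntegral.integral_undef this, add_zero]
  have hT : IntervalIntegrable (fun r => F (y r) (d r)) volume t T := by
    obtain ⟨B, hB⟩ := (isCompact_Icc (a := t) (b := T)).exists_bound_of_continuousOn
      hz.continuousOn
    refine hF.intervalIntegrable_of_bound (B := max B ‖x‖) hd hdD htT ?_ ?_
    · refine (Measurable.ite hAm hz.measurable measurable_const).aemeasurable.congr
        (f := fun r => if r ∈ A then z r else x) ?_
      exact (ae_restrict_iff' measurableSet_Ioc).2
        (Eventually.of_forall fun r hr => (hyA r (Ioc_subset_Icc_self hr)).symm)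
    · intro r hr
      rw [hyA r (Ioc_subset_Icc_self hr)]
      split_ifs
      · exact (hB r (Ioc_subset_Icc_self hr)).trans (le_max_left _ _)
      · exact le_max_right _ _
  exact fun s hs => heq s hs (hmono hs.1 hs.2 hT)

/-- Comparison of two continuous trajectories driven by the same uncertainty, started at different
times from different states. -/
lemma norm_sub_max_le (hF : IsLipschitzDynamics F D K M) (hd : Measurable d)
    (hdD : ∀ s, d s ∈ D) {t₁ t₂ V : ℝ} {x₁ x₂ : EucSp n} {y₁ y₂ : ℝ → EucSp n}
    (h12 : t₁ ≤ t₂) (h2T : t₂ ≤ T) (hy₁ : Continuous y₁) (hy₂ : Continuous y₂)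
    (h₁ : IsTraj F d t₁ T x₁ y₁) (h₂ : IsTraj F d t₂ T x₂ y₂)
    (hV : ∀ r ∈ Icc t₁ T, ‖F (y₁ r) (d r)‖ ≤ V) :
    ∀ s ∈ Icc t₁ T, ‖y₁ s - y₂ (max s t₂)‖
      ≤ (‖x₁ - x₂‖ + V * (t₂ - t₁)) * Real.exp (K * (T - t₁)) := by
  have hV0 : 0 ≤ V := (norm_nonneg _).trans (hV t₁ ⟨le_rfl, h12.trans h2T⟩)
  have hK := hF.nonneg_lipschitz
  have hearly : ∀ s ∈ Icc t₁ t₂, ‖y₁ s - x₂‖ ≤ ‖x₁ - x₂‖ + V * (t₂ - t₁) := by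
    intro s hs
    have hint : ‖∫ r in t₁..s, F (y₁ r) (d r)‖ ≤ V * |s - t₁| :=
      intervalIntegral.norm_integral_le_of_norm_le_const fun r hr => by
        rw [uIoc_of_le hs.1] at hr
        exact hV r ⟨hr.1.le, hr.2.trans (hs.2.trans h2T)⟩
    rw [abs_of_nonneg (sub_nonneg.2 hs.1)] at hint
    have heq : y₁ s - x₂ = (x₁ - x₂) + ∫ r in t₁..s, F (y₁ r) (d r) := by
      rw [h₁.2 s ⟨hs.1, hs.2.trans h2T⟩]
      abel
    rw [heq]
    have : V * (s - t₁) ≤ V * (t₂ - t₁) := mul_le_mul_of_nonneg_left (by linarith [hs.2]) hV0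
    exact (norm_add_le _ _).trans (by linarith)
  have hsum : 0 ≤ ‖x₁ - x₂‖ + V * (t₂ - t₁) :=
    add_nonneg (norm_nonneg _) (mul_nonneg hV0 (sub_nonneg.2 h12))
  intro s hs
  rcases le_total s t₂ with hst | hst
  · rw [max_eq_right hst, h₂.1]
    refine (hearly s ⟨hs.1, hst⟩).trans (le_mul_of_one_le_right hsum ?_)
    exact Real.one_le_exp (mul_nonneg hK (by linarith))
  · rw [max_eq_left hst]
    have hrestr : IsTraj F d t₂ T (y₁ t₂) y₁ := by
      refine ⟨rfl, fun r hr => ?_⟩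
      rw [h₁.2 r ⟨h12.trans hr.1, hr.2⟩, h₁.2 t₂ ⟨h12, h2T⟩, add_assoc,
        intervalIntegral.integral_add_adjacent_intervals
          (hF.intervalIntegrable hd hdD h12 hy₁.continuousOn)
          (hF.intervalIntegrable hd hdD hr.1 hy₁.continuousOn)]
    refine (hF.norm_sub_le hd hdD hy₁.continuousOn hy₂.continuousOn hrestr h₂ s
      ⟨hst, hs.2⟩).trans ?_
    refine mul_le_mul (hearly t₂ ⟨h12, le_rfl⟩) (Real.exp_le_exp.2 ?_) (Real.exp_pos _).le hsum
    exact mul_le_mul_of_nonneg_left (by linarith [hs.2]) hK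

end IsLipschitzDynamics

/-- An admissible uncertainty agrees on `[t, T]` with a measurable map taking values in `D`
everywhere. -/
lemma Admissible.exists_extension {m : ℕ} {D : Set (EucSp m)} {t T : ℝ} {d : ℝ → EucSp m}
    (hD : D.Nonempty) (hd : Admissible D t T d) :
    ∃ d', Measurable d' ∧ (∀ s, d' s ∈ D) ∧ EqOn d d' (Icc t T) := by
  classical
  obtain ⟨v, hv⟩ := hD
  refine ⟨fun s => if s ∈ Icc t T then d s else v,
    Measurable.ite measurableSet_Icc hd.1 measurable_const, fun s => ?_, fun s hs => ?_⟩
  · dsimp only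
    split_ifs with h
    exacts [hd.2 s h, hv]
  · exact (if_pos hs).symm

lemma IsTraj.congr_uncertainty {n m : ℕ} {F : EucSp n → EucSp m → EucSp n} {d d' : ℝ → EucSp m}
    {t T : ℝ} {x : EucSp n} {y : ℝ → EucSp n} (h : IsTraj F d t T x y)
    (hd : EqOn d d' (Icc t T)) : IsTraj F d' t T x y := by
  refine ⟨h.1, fun s hs => ?_⟩
  rw [h.2 s hs]
  congr 1
  refine intervalIntegral.integral_congr fun r hr => ?_
  rw [uIcc_of_le hs.1] at hr
  simp only [hd ⟨hr.1, hr.2.trans hs.2⟩]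

section Payoff

variable {n nX nTR : ℕ} {g : Fin nX → EucSp n → ℝ → ℝ} {l : Fin nTR → EucSp n → ℝ}

lemma payoff_congr {t T : ℝ} (htT : t ≤ T) {y z : ℝ → EucSp n} (h : EqOn y z (Icc t T)) :
    payoff g l t T y = payoff g l t T z := by
  have himage : ∀ i, (fun s => g i (y s) s) '' Icc t T = (fun s => g i (z s) s) '' Icc t T :=
    fun i => image_congr fun s hs => by simp only [h hs]
  simp only [payoff, himage, h ⟨htT, le_rfl⟩]

lemma payoff_le (hnX : 0 < nX) (hnTR : 0 < nTR) {t T B : ℝ} (htT : t ≤ T) {y : ℝ → EucSp n}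
    (hl : ∀ j, l j (y T) ≤ B) (hg : ∀ i, ∀ s ∈ Icc t T, g i (y s) s ≤ B) :
    payoff g l t T y ≤ B := by
  have : Nonempty (Fin nX) := ⟨⟨0, hnX⟩⟩
  have : Nonempty (Fin nTR) := ⟨⟨0, hnTR⟩⟩
  refine max_le (ciSup_le hl) (ciSup_le fun i => csSup_le ((nonempty_Icc.2 htT).image _) ?_)
  rintro _ ⟨s, hs, rfl⟩
  exact hg i s hs

lemma terminal_le_payoff {t T : ℝ} (y : ℝ → EucSp n) (j : Fin nTR) :
    l j (y T) ≤ payoff g l t T y :=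
  (le_ciSup (f := fun j => l j (y T)) (finite_range _).bddAbove j).trans (le_max_left _ _)

lemma running_le_payoff {t T : ℝ} {y : ℝ → EucSp n} {i : Fin nX}
    (hb : BddAbove ((fun s => g i (y s) s) '' Icc t T)) {s : ℝ} (hs : s ∈ Icc t T) :
    g i (y s) s ≤ payoff g l t T y :=
  ((le_csSup hb (mem_image_of_mem _ hs)).trans
    (le_ciSup (f := fun i => sSup ((fun s => g i (y s) s) '' Icc t T))
      (finite_range _).bddAbove i)).trans (le_max_right _ _)

lemma payoff_le_payoff_add (hnX : 0 < nX) (hnTR : 0 < nTR) {t₁ t₂ T ε : ℝ} (h1T : t₁ ≤ T)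
    {y₁ y₂ : ℝ → EucSp n} (hb : ∀ i, BddAbove ((fun s => g i (y₂ s) s) '' Icc t₂ T))
    (hl : ∀ j, l j (y₁ T) ≤ l j (y₂ T) + ε)
    (hg : ∀ i, ∀ s ∈ Icc t₁ T, ∃ s' ∈ Icc t₂ T, g i (y₁ s) s ≤ g i (y₂ s') s' + ε) :
    payoff g l t₁ T y₁ ≤ payoff g l t₂ T y₂ + ε := by
  refine payoff_le hnX hnTR h1T
    (fun j => (hl j).trans (add_le_add_left (terminal_le_payoff y₂ j) ε)) fun i s hs => ?_
  obtain ⟨s', hs', h⟩ := hg i s hs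
  exact h.trans (add_le_add_left (running_le_payoff (hb i) hs') ε)

end Payoff

/-- A finite family of locally Lipschitz functions has a common Lipschitz constant on a compact
set. -/
lemma exists_common_lipschitz_of_compact {ι α : Type*} [Finite ι] [PseudoMetricSpace α]
    {f : ι → α → ℝ} (hf : ∀ i, LocallyLipschitz (f i)) {S : Set α} (hS : IsCompact S) :
    ∃ L : ℝ, 0 ≤ L ∧ ∀ i, ∀ p ∈ S, ∀ q ∈ S, f i p ≤ f i q + L * dist p q := by
  choose C hC using fun i =>
    ((hf i).locallyLipschitzOn (s := S)).exists_lipschitzOnWith_of_compact hS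
  obtain ⟨L, hL⟩ := (finite_range C).bddAbove
  refine ⟨L, L.2, fun i p hp q hq => ?_⟩
  have h1 := (hC i).dist_le_mul p hp q hq
  have h2 : (C i : ℝ) ≤ L := hL (mem_range_self i)
  have h3 := mul_le_mul_of_nonneg_right h2 (dist_nonneg (x := p) (y := q))
  have h4 := le_abs_self (f i p - f i q)
  rw [Real.dist_eq] at h1
  linarith

/-- The value function is locally Lipschitz continuous on `ℝⁿ × [0, T]`. -/
theorem stmt2
    {n m nX nTR : ℕ} (hn : 0 < n) (hm : 0 < m) (hnX : 0 < nX) (hnTR : 0 < nTR)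
    (T : ℝ) (hT : 0 < T)
    (D : Set (EucSp m)) (hDne : D.Nonempty) (hDcomp : IsCompact D)
    (F : EucSp n → EucSp m → EucSp n)
    (hFcont : Continuous fun p : EucSp n × EucSp m => F p.1 p.2)
    (LF : ℝ) (hLF : 0 ≤ LF)
    (hFlip : ∀ x y : EucSp n, ∀ d ∈ D, ‖F x d - F y d‖ ≤ LF * ‖x - y‖)
    (g : Fin nX → EucSp n → ℝ → ℝ) (l : Fin nTR → EucSp n → ℝ)
    (hg : ∀ i, LocallyLipschitz fun p : EucSp n × ℝ => g i p.1 p.2)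
    (hl : ∀ j, LocallyLipschitz (l j))
    (u : EucSp n → ℝ → ℝ) (hu : IsValueFun F D g l T u)
 :
    ∀ 𝒳 : Set (EucSp n), IsCompact 𝒳 → ∃ C, 0 ≤ C ∧
      ∀ x₁ ∈ 𝒳, ∀ x₂ ∈ 𝒳, ∀ t₁ ∈ Set.Icc (0:ℝ) T, ∀ t₂ ∈ Set.Icc (0:ℝ) T,
        |u x₁ t₁ - u x₂ t₂| ≤ C * (‖x₁ - x₂‖ + |t₁ - t₂|) := by
  obtain ⟨M, hM⟩ := hDcomp.exists_bound_of_continuousOn (f := fun d => F 0 d)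
    (hFcont.comp (continuous_const.prodMk continuous_id)).continuousOn
  have hM0 : 0 ≤ M := (norm_nonneg _).trans (hM _ hDne.some_mem)
  have hF : IsLipschitzDynamics F D LF M := ⟨hFcont, hFlip, hLF, hM0, hM⟩
  intro 𝒳 h𝒳
  obtain ⟨ρ, hρ0, hρ⟩ := h𝒳.isBounded.exists_pos_norm_le
  set E : ℝ := Real.exp (LF * T) with hE
  have hE0 : 0 < E := Real.exp_pos _
  set R : ℝ := (ρ + M * T) * E with hR
  have hR0 : 0 ≤ R := by positivity
  have hball : ∀ x ∈ 𝒳, ∀ t ∈ Icc (0 : ℝ) T, ∀ d y, (∀ s, d s ∈ D) → Continuous y →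
      IsTraj F d t T x y → ∀ s ∈ Icc t T, ‖y s‖ ≤ R := by
    intro x hx t ht d y hdD hyc hy s hs
    refine (hF.norm_traj_le hdD hyc.continuousOn hy s hs).trans ?_
    have h1 : M * (T - t) ≤ M * T := mul_le_mul_of_nonneg_left (by linarith [ht.1]) hM0
    refine mul_le_mul (by linarith [hρ x hx]) (Real.exp_le_exp.2 ?_) (Real.exp_pos _).le
      (by positivity)
    exact mul_le_mul_of_nonneg_left (by linarith [ht.1, hs.2]) hLF
  have hSl : IsCompact (Metric.closedBall (0 : EucSp n) R) := isCompact_closedBall _ _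
  have hSg := hSl.prod (isCompact_Icc (a := (0 : ℝ)) (b := T))
  obtain ⟨Lg, hLg0, hLg⟩ := exists_common_lipschitz_of_compact hg hSg
  obtain ⟨Ll, hLl0, hLl⟩ := exists_common_lipschitz_of_compact hl hSl
  have hmeml : ∀ {v : EucSp n}, ‖v‖ ≤ R → v ∈ Metric.closedBall (0 : EucSp n) R :=
    fun h => mem_closedBall_zero_iff.2 h
  have hbddg : ∀ i, ∃ B, ∀ v s, ‖v‖ ≤ R → s ∈ Icc (0 : ℝ) T → g i v s ≤ B := by
    intro i
    obtain ⟨B, hB⟩ := hSg.bddAbove_image (hg i).continuous.continuousOn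
    exact ⟨B, fun v s hv hs => hB (mem_image_of_mem _ (mk_mem_prod (hmeml hv) hs))⟩
  have hbddl : ∀ j, ∃ B, ∀ v, ‖v‖ ≤ R → l j v ≤ B := by
    intro j
    obtain ⟨B, hB⟩ := hSl.bddAbove_image (hl j).continuous.continuousOn
    exact ⟨B, fun v hv => hB (mem_image_of_mem _ (hmeml hv))⟩
  choose Bg hBg using hbddg
  choose Bl hBl using hbddl
  obtain ⟨Bg', hBg'⟩ := (finite_range Bg).bddAbove
  obtain ⟨Bl', hBl'⟩ := (finite_range Bl).bddAbove
  -- Every admissible pair may be replaced by one with a global uncertainty and a continuous path.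
  have hregular : ∀ x, ∀ t ∈ Icc (0 : ℝ) T, ∀ d y, Admissible D t T d → IsTraj F d t T x y →
      ∃ d' z, Measurable d' ∧ (∀ s, d' s ∈ D) ∧ Continuous z ∧ IsTraj F d' t T x z ∧
        payoff g l t T y = payoff g l t T z := by
    intro x t ht d y hd hy
    obtain ⟨d', hd'm, hd'D, hdd'⟩ := hd.exists_extension hDne
    obtain ⟨z, hzc, hz⟩ := hF.exists_traj hd'm hd'D ht.2 x
    exact ⟨d', z, hd'm, hd'D, hzc, hz,
      payoff_congr ht.2 (hF.traj_eqOn hd'm hd'D ht.2 hzc hz (hy.congr_uncertainty hdd'))⟩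
  have hbdd : ∀ x ∈ 𝒳, ∀ t ∈ Icc (0 : ℝ) T, BddAbove {r | ∃ d y, Admissible D t T d ∧
      IsTraj F d t T x y ∧ r = payoff g l t T y} := by
    intro x hx t ht
    refine ⟨max Bl' Bg', ?_⟩
    rintro _ ⟨d, y, hd, hy, rfl⟩
    obtain ⟨d', z, hd'm, hd'D, hzc, hz, hpay⟩ := hregular x t ht d y hd hy
    have hzR := hball x hx t ht d' z hd'D hzc hz
    rw [hpay]
    refine payoff_le hnX hnTR ht.2 (fun j => ?_) fun i s hs => ?_
    · exact ((hBl j _ (hzR T ⟨ht.2, le_rfl⟩)).trans (hBl' (mem_range_self j))).trans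
        (le_max_left _ _)
    · exact ((hBg i _ s (hzR s hs) ⟨ht.1.trans hs.1, hs.2⟩).trans
        (hBg' (mem_range_self i))).trans (le_max_right _ _)
  have hne : ∀ x, ∀ t ∈ Icc (0 : ℝ) T, Set.Nonempty {r | ∃ d y, Admissible D t T d ∧
      IsTraj F d t T x y ∧ r = payoff g l t T y} := by
    intro x t ht
    obtain ⟨v, hv⟩ := hDne
    obtain ⟨z, -, hz⟩ := hF.exists_traj (d := fun _ => v) measurable_const (fun _ => hv) ht.2 x
    exact ⟨_, fun _ => v, z, ⟨measurable_const, fun _ _ => hv⟩, hz, rfl⟩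
  set V : ℝ := M + LF * R with hV
  have hV0 : 0 ≤ V := by positivity
  have hdist : ∀ x₁ ∈ 𝒳, ∀ x₂ ∈ 𝒳, ∀ t₁ ∈ Icc (0 : ℝ) T, ∀ t₂ ∈ Icc (0 : ℝ) T, ∀ d y₁ y₂,
      Measurable d → (∀ s, d s ∈ D) → Continuous y₁ → Continuous y₂ → IsTraj F d t₁ T x₁ y₁ →
      IsTraj F d t₂ T x₂ y₂ → t₁ ≤ t₂ → ∀ s ∈ Icc t₁ T,
      ‖y₁ s - y₂ (max s t₂)‖ ≤ (1 + V) * E * (‖x₁ - x₂‖ + |t₁ - t₂|) := by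
    intro x₁ hx₁ x₂ hx₂ t₁ ht₁ t₂ ht₂ d y₁ y₂ hd hdD hc₁ hc₂ hy₁ hy₂ h12 s hs
    refine (hF.norm_sub_max_le (V := V) hd hdD h12 ht₂.2 hc₁ hc₂ hy₁ hy₂ (fun r hr => ?_)
      s hs).trans ?_
    · refine (hF.norm_le _ (hdD r)).trans ?_
      have := mul_le_mul_of_nonneg_left (hball x₁ hx₁ t₁ ht₁ d y₁ hdD hc₁ hy₁ r hr) hLF
      linarith
    · rw [abs_sub_comm, abs_of_nonneg (sub_nonneg.2 h12)]
      have h1 : Real.exp (LF * (T - t₁)) ≤ E :=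
        Real.exp_le_exp.2 (mul_le_mul_of_nonneg_left (by linarith [ht₁.1]) hLF)
      have h2 : ‖x₁ - x₂‖ + V * (t₂ - t₁) ≤ (1 + V) * (‖x₁ - x₂‖ + (t₂ - t₁)) := by
        nlinarith [norm_nonneg (x₁ - x₂), mul_nonneg hV0 (norm_nonneg (x₁ - x₂))]
      have h3 : 0 ≤ (1 + V) * (‖x₁ - x₂‖ + (t₂ - t₁)) :=
        mul_nonneg (by linarith) (add_nonneg (norm_nonneg _) (sub_nonneg.2 h12))
      exact (mul_le_mul h2 h1 (Real.exp_pos _).le h3).trans_eq (by ring)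
  have hkey : ∀ x₁ ∈ 𝒳, ∀ x₂ ∈ 𝒳, ∀ t₁ ∈ Icc (0 : ℝ) T, ∀ t₂ ∈ Icc (0 : ℝ) T,
      u x₁ t₁ ≤ u x₂ t₂ + (Lg + Ll) * ((1 + V) * E + 1) * (‖x₁ - x₂‖ + |t₁ - t₂|) := by
    intro x₁ hx₁ x₂ hx₂ t₁ ht₁ t₂ ht₂
    rw [hu x₁ t₁ ht₁]
    refine csSup_le (hne x₁ t₁ ht₁) ?_
    rintro _ ⟨d₀, y₀, hd₀, hy₀, rfl⟩
    obtain ⟨d, y₁, hd, hdD, hc₁, hy₁, hpay⟩ := hregular x₁ t₁ ht₁ d₀ y₀ hd₀ hy₀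
    obtain ⟨y₂, hc₂, hy₂⟩ := hF.exists_traj hd hdD ht₂.2 x₂
    have hR₁ := hball x₁ hx₁ t₁ ht₁ d y₁ hdD hc₁ hy₁
    have hR₂ := hball x₂ hx₂ t₂ ht₂ d y₂ hdD hc₂ hy₂
    set δ : ℝ := ‖x₁ - x₂‖ + |t₁ - t₂| with hδ
    have hδ0 : 0 ≤ δ := by positivity
    have htδ : |t₁ - t₂| ≤ δ := le_add_of_nonneg_left (norm_nonneg _)
    have hclose : ∀ s ∈ Icc t₁ T, ‖y₁ s - y₂ (max s t₂)‖ ≤ (1 + V) * E * δ := by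
      intro s hs
      rcases le_total t₁ t₂ with h12 | h12
      · exact hdist x₁ hx₁ x₂ hx₂ t₁ ht₁ t₂ ht₂ d y₁ y₂ hd hdD hc₁ hc₂ hy₁ hy₂ h12 s hs
      · have := hdist x₂ hx₂ x₁ hx₁ t₂ ht₂ t₁ ht₁ d y₂ y₁ hd hdD hc₂ hc₁ hy₂ hy₁ h12 s
          ⟨h12.trans hs.1, hs.2⟩
        rw [max_eq_left hs.1, norm_sub_rev, norm_sub_rev x₂, abs_sub_comm t₂] at this
        rwa [max_eq_left (h12.trans hs.1)]
    have hW0 : 0 ≤ (1 + V) * E * δ := by positivity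
    refine le_trans ?_ (add_le_add_left
      ((le_csSup (hbdd x₂ hx₂ t₂ ht₂) ⟨d, y₂, ⟨hd, fun s _ => hdD s⟩, hy₂, rfl⟩).trans_eq
        (hu x₂ t₂ ht₂).symm) _)
    rw [hpay]
    refine payoff_le_payoff_add hnX hnTR ht₁.2 (fun i => ?_) (fun j => ?_) fun i s hs => ?_
    · refine ⟨Bg i, ?_⟩
      rintro _ ⟨s, hs, rfl⟩
      exact hBg i _ s (hR₂ s hs) ⟨ht₂.1.trans hs.1, hs.2⟩
    · have h1 := hLl j _ (hmeml (hR₁ T ⟨ht₁.2, le_rfl⟩)) _ (hmeml (hR₂ T ⟨ht₂.2, le_rfl⟩))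
      have h2 := hclose T ⟨ht₁.2, le_rfl⟩
      rw [max_eq_left ht₂.2, ← dist_eq_norm] at h2
      have h3 := mul_le_mul_of_nonneg_left h2 hLl0
      have h4 : 0 ≤ Lg * ((1 + V) * E * δ) := mul_nonneg hLg0 hW0
      have h5 : 0 ≤ (Lg + Ll) * δ := by positivity
      refine h1.trans ?_
      rw [add_le_add_iff_left]
      linarith
    · have hs' : max s t₂ ∈ Icc t₂ T := ⟨le_max_right _ _, max_le hs.2 ht₂.2⟩
      refine ⟨max s t₂, hs', ?_⟩
      have h1 := hLg i (y₁ s, s) (mk_mem_prod (hmeml (hR₁ s hs)) ⟨ht₁.1.trans hs.1, hs.2⟩)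
        (y₂ (max s t₂), max s t₂) (mk_mem_prod (hmeml (hR₂ _ hs')) ⟨ht₂.1.trans hs'.1, hs'.2⟩)
      have h2 : |s - max s t₂| ≤ δ := by
        refine le_trans ?_ htδ
        rcases le_total s t₂ with h | h
        · rw [max_eq_right h, abs_sub_comm, abs_of_nonneg (sub_nonneg.2 h), abs_sub_comm]
          exact (sub_le_sub_left hs.1 t₂).trans (le_abs_self _)
        · rw [max_eq_left h, sub_self, abs_zero]
          exact abs_nonneg _
      have h3 : dist (y₁ s, s) (y₂ (max s t₂), max s t₂) ≤ (1 + V) * E * δ + δ := by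
        rw [Prod.dist_eq, dist_eq_norm, Real.dist_eq]
        exact max_le (by linarith [hclose s hs]) (by linarith)
      have h4 := mul_le_mul_of_nonneg_left h3 hLg0
      have h5 : 0 ≤ Ll * ((1 + V) * E * δ + δ) := by positivity
      refine h1.trans ?_
      rw [add_le_add_iff_left]
      linarith
  refine ⟨(Lg + Ll) * ((1 + V) * E + 1), by positivity, ?_⟩
  intro x₁ hx₁ x₂ hx₂ t₁ ht₁ t₂ ht₂
  have h1 := hkey x₁ hx₁ x₂ hx₂ t₁ ht₁ t₂ ht₂
  have h2 := hkey x₂ hx₂ x₁ hx₁ t₂ ht₂ t₁ ht₁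
  rw [norm_sub_rev, abs_sub_comm t₂] at h2
  rw [abs_le]
  constructor <;> linarith

end
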